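/- arXiv:math/9307222 — 6 statements merged into one kernel-verified Lean document; each statement's English description precedes it below -/
import Mathlib

section
/- Let k be a positive integer, let α, β, γ be real numbers with α > −2 and γ > −1, and let a_1, …, a_k be real numbers with |a_j| < 1 for all j. Then the integral g(α, β, γ) = ∫₀^1 x^γ·(1 − x)^{α+1}·∏_{j=1}^k (1 + a_j x)^β dx equals B(γ+1, α+2) times the Lauricella-type series Σ over all multi-indices m = (m_1, …, m_k) ∈ ℕ^k of [ (γ+1)_{|m|} / (γ+α+3)_{|m|} ] · ∏_{j=1}^k [ (−β)_{m_j} · (−a_j)^{m_j} / m_j! ], where |m| = m_1 + ⋯ + m_k; moreover this multiple series converges absolutely. -/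
open Real MeasureTheory Finset

/-- Euler's Beta function. -/
noncomputable def eulerBeta (p q : ℝ) : ℝ := Real.Gamma p * Real.Gamma q / Real.Gamma (p + q)

theorem lum_congr {ι : Type} {f g : ι → ℝ} {s : ℝ} (h : HasSum f s) (hfg : ∀ n, g n = f n) :
    HasSum g s := by
  rwa [funext hfg]

theorem lum_binomial (β y : ℝ) (hy : |y| < 1) :
    HasSum (fun n : ℕ => (ascPochhammer ℝ n).eval (-β) * (-y) ^ n / (Nat.factorial n : ℝ))
      ((1 + y) ^ β) := by
  have h := (Real.one_add_rpow_hasFPowerSeriesOnBall_zero (a := β)).hasSum (y := y)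
    (by simpa [enorm_eq_nnnorm, ← NNReal.coe_lt_coe] using hy)
  rw [zero_add] at h
  refine lum_congr h ?_
  intro n
  have h1 := Polynomial.ascPochhammer_smeval_neg_eq_descPochhammer β n
  have h2 := Ring.descPochhammer_eq_factorial_smul_choose β n
  have h3 : (n.factorial : ℝ) ≠ 0 := by positivity
  rw [Polynomial.ascPochhammer_smeval_eq_eval, h2] at h1
  rw [h1]
  rw [binomialSeries_apply, neg_pow, Int.negOnePow_def]
  simp only [List.ofFn_const, List.prod_replicate, nsmul_eq_mul, smul_eq_mul]
  rw [Units.smul_def]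
  simp only [zpow_natCast, Units.val_pow_eq_pow_val, Units.val_neg, Units.val_one, zsmul_eq_mul,
    Int.cast_pow, Int.cast_neg, Int.cast_one]
  have h4 : ((-1:ℝ) ^ n) * (-1) ^ n = 1 := by rw [← mul_pow]; simp
  field_simp
  linear_combination (Ring.choose β n * y ^ n) * h4

theorem lum_prod : ∀ (k : ℕ) (f : Fin k → ℕ → ℝ) (s : Fin k → ℝ)
    (_ : ∀ j, HasSum (f j) (s j)),
    HasSum (fun m : Fin k → ℕ => ∏ j, f j (m j)) (∏ j, s j)
  | 0, f, s, h => by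
    simpa using hasSum_unique (fun m : Fin 0 → ℕ => (1:ℝ))
  | k + 1, f, s, h => by
    have ih := lum_prod k (fun j => f j.succ) (fun j => s j.succ) (fun j => h j.succ)
    have h0 := h 0
    have hs := summable_mul_of_summable_norm h0.summable.norm ih.summable.norm
    have := h0.mul ih hs
    rw [← (Fin.consEquiv (fun _ : Fin (k+1) => ℕ)).hasSum_iff, Fin.prod_univ_succ]
    refine lum_congr this ?_
    intro p
    simp [Fin.prod_univ_succ, Fin.consEquiv]

theorem lum_gamma (n : ℕ) (s : ℝ) (hs : 0 < s) :
    Real.Gamma (s + n) = (ascPochhammer ℝ n).eval s * Real.Gamma s := by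
  induction n with
  | zero => simp
  | succ n ih =>
    have : s + (n:ℝ) ≠ 0 := by positivity
    rw [Nat.cast_succ, ← add_assoc, Real.Gamma_add_one this, ih, ascPochhammer_succ_right]
    simp
    ring

theorem lum_cast (p q x : ℝ) (hx : x ∈ Set.uIcc (0:ℝ) 1) :
    (x : ℂ) ^ ((p:ℂ) - 1) * (1 - (x : ℂ)) ^ ((q:ℂ) - 1) =
      ((x ^ (p - 1) * (1 - x) ^ (q - 1) : ℝ) : ℂ) := by
  rw [Set.uIcc_of_le zero_le_one] at hx
  rw [Complex.ofReal_mul, Complex.ofReal_cpow hx.1, Complex.ofReal_cpow (by linarith [hx.2])]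
  push_cast
  rfl

theorem lum_beta (p q : ℝ) (hp : 0 < p) (hq : 0 < q) :
    ∫ x in (0:ℝ)..1, x ^ (p - 1) * (1 - x) ^ (q - 1) = eulerBeta p q := by
  have h := ProbabilityTheory.beta_eq_betaIntegralReal p q hp hq
  rw [Complex.betaIntegral, intervalIntegral.integral_congr (fun x hx => lum_cast p q x hx),
    intervalIntegral.integral_ofReal, Complex.ofReal_re] at h
  exact h.symm

theorem lum_beta_integrable (p q : ℝ) (hp : 0 < p) (hq : 0 < q) :
    IntervalIntegrable (fun x : ℝ => x ^ (p - 1) * (1 - x) ^ (q - 1)) volume 0 1 := by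
  have h := Complex.betaIntegral_convergent (u := p) (v := q) (by simpa) (by simpa)
  have h2 : IntervalIntegrable (fun x : ℝ => ((x ^ (p - 1) * (1 - x) ^ (q - 1) : ℝ) : ℂ))
      volume 0 1 :=
    h.congr (fun x hx => lum_cast p q x (Set.uIoc_subset_uIcc hx))
  rw [intervalIntegrable_iff] at h2 ⊢
  simpa [IntegrableOn] using h2.re

theorem lum_moment (α γ : ℝ) (hα : -2 < α) (hγ : -1 < γ) (n : ℕ) :
    ∫ x in (0:ℝ)..1, x ^ γ * (1 - x) ^ (α + 1) * x ^ n =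
      eulerBeta (γ + 1) (α + 2) * ((ascPochhammer ℝ n).eval (γ + 1) /
            (ascPochhammer ℝ n).eval (γ + α + 3)) := by
  have h := lum_beta (γ + 1 + n) (α + 2) (by have := n.cast_nonneg (α := ℝ); linarith) (by linarith)
  have h1 : ∫ x in (0:ℝ)..1, x ^ γ * (1 - x) ^ (α + 1) * x ^ n =
      ∫ x in (0:ℝ)..1, x ^ (γ + 1 + n - 1) * (1 - x) ^ (α + 2 - 1) := by
    apply intervalIntegral.integral_congr_ae
    refine Filter.Eventually.of_forall fun x hx => ?_
    rw [Set.uIoc_of_le zero_le_one] at hx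
    rw [show γ + 1 + n - 1 = γ + n by ring, show α + 2 - 1 = α + 1 by ring,
      Real.rpow_add_natCast hx.1.ne']
    ring
  rw [h1, h]
  unfold eulerBeta
  rw [show γ + 1 + n + (α + 2) = (γ + α + 3) + n by ring, lum_gamma n _ (by linarith),
    lum_gamma n _ (by linarith), show γ + 1 + (α + 2) = γ + α + 3 by ring]
  rw [mul_comm (Polynomial.eval _ _), mul_comm (Polynomial.eval _ _), div_mul_div_comm]
  ring

theorem luminosity_integral_lauricella (k : ℕ) (hk : 0 < k)
    (α β γ : ℝ) (hα : -2 < α) (hγ : -1 < γ)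
    (a : Fin k → ℝ) (ha : ∀ j, |a j| < 1) :
    HasSum
      (fun m : Fin k → ℕ =>
        eulerBeta (γ + 1) (α + 2) *
          ((ascPochhammer ℝ (∑ j, m j)).eval (γ + 1) /
            (ascPochhammer ℝ (∑ j, m j)).eval (γ + α + 3)) *
          ∏ j, ((ascPochhammer ℝ (m j)).eval (-β) * (-(a j)) ^ (m j) /
            (Nat.factorial (m j) : ℝ)))
      (∫ x in (0:ℝ)..1, x ^ γ * (1 - x) ^ (α + 1) * ∏ j, (1 + a j * x) ^ β) := by
  set c : (Fin k → ℕ) → ℝ := fun m => ∏ j, ((ascPochhammer ℝ (m j)).eval (-β) * (-(a j)) ^ (m j) /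
            (Nat.factorial (m j) : ℝ)) with hc
  have hcs : Summable c := (lum_prod k _ _ (fun j => lum_binomial β (a j) (ha j))).summable
  have hW : IntervalIntegrable (fun x : ℝ => x ^ γ * (1 - x) ^ (α + 1)) volume 0 1 := by
    have := lum_beta_integrable (γ + 1) (α + 2) (by linarith) (by linarith)
    rwa [show γ + 1 - 1 = γ by ring, show α + 2 - 1 = α + 1 by ring] at this
  have key : HasSum (fun m : Fin k → ℕ =>
      ∫ x in (0:ℝ)..1, x ^ γ * (1 - x) ^ (α + 1) * (c m * x ^ (∑ j, m j)))
      (∫ x in (0:ℝ)..1, x ^ γ * (1 - x) ^ (α + 1) * ∏ j, (1 + a j * x) ^ β) := by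
    refine intervalIntegral.hasSum_integral_of_dominated_convergence
      (fun m x => x ^ γ * (1 - x) ^ (α + 1) * |c m|) ?_ ?_ ?_ ?_ ?_
    · intro m
      apply Measurable.aestronglyMeasurable
      fun_prop
    · refine fun m => Filter.Eventually.of_forall fun x hx => ?_
      rw [Set.uIoc_of_le zero_le_one] at hx
      have h1 : 0 ≤ x ^ γ := Real.rpow_nonneg hx.1.le _
      have h2 : 0 ≤ (1 - x) ^ (α + 1) := Real.rpow_nonneg (by linarith [hx.2]) _
      have h3 : x ^ (∑ j, m j) ≤ 1 := pow_le_one₀ hx.1.le hx.2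
      have h4 : 0 ≤ x ^ (∑ j, m j) := pow_nonneg hx.1.le _
      rw [Real.norm_eq_abs, abs_mul, abs_of_nonneg (mul_nonneg h1 h2), abs_mul, abs_of_nonneg h4]
      exact mul_le_mul_of_nonneg_left (mul_le_of_le_one_right (abs_nonneg _) h3) (mul_nonneg h1 h2)
    · exact Filter.Eventually.of_forall fun x _ => hcs.abs.mul_left _
    · simp_rw [tsum_mul_left]
      exact hW.mul_const _
    · refine Filter.Eventually.of_forall fun x hx => ?_
      rw [Set.uIoc_of_le zero_le_one] at hx
      apply HasSum.mul_left
      have := lum_prod k _ _ (fun j => lum_binomial β (a j * x) (by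
        rw [abs_mul, abs_of_pos hx.1]
        exact (mul_le_of_le_one_right (abs_nonneg _) hx.2).trans_lt (ha j)))
      refine lum_congr this ?_
      intro m
      simp only [hc]
      rw [← Finset.prod_pow_eq_pow_sum, ← Finset.prod_mul_distrib]
      refine Finset.prod_congr rfl fun j _ => ?_
      rw [← neg_mul, mul_pow]
      ring
  refine lum_congr key ?_
  intro m
  rw [← lum_moment α γ hα hγ, ← intervalIntegral.integral_mul_const]
  congr 1
  ext x
  ring
end

section
/- Let ρ_c > 0, R > 0, G > 0, δ > 0 be real numbers, let ρ(t) = ρ_c·(1 − (t/R)^δ) and M(t) = (4π/3)·ρ_c·R³·(t/R)³·(1 − 3(t/R)^δ/(δ+3)). Then for every r with 0 ≤ r ≤ R, writing x = r/R, the pressure satisfies P(r) = G·∫_r^R (M(t)/t²)·ρ(t) dt = (4πG/3)·ρ_c²·R²·{ ψ − x²/2 + [(δ+6)/((δ+2)(δ+3))]·x^{δ+2} − [3/(2(δ+1)(δ+3))]·x^{2δ+2} }, where ψ = 1/2 − (δ+6)/((δ+2)(δ+3)) + 3/(2(δ+1)(δ+3)). -/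
open Real MeasureTheory

theorem general_model_pressure (ρc R G δ : ℝ)
    (hρc : 0 < ρc) (hR : 0 < R) (hG : 0 < G) (hδ : 0 < δ)
    (ρ M : ℝ → ℝ)
    (hρ : ∀ t, ρ t = ρc * (1 - (t / R) ^ δ))
    (hM : ∀ t, M t = (4 * π / 3) * ρc * R ^ 3 * (t / R) ^ 3 * (1 - 3 * (t / R) ^ δ / (δ + 3)))
    (r : ℝ) (hr0 : 0 ≤ r) (hrR : r ≤ R) :
    G * ∫ t in r..R, (M t / t ^ 2) * ρ t =
      (4 * π * G / 3) * ρc ^ 2 * R ^ 2 *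
        ((1 / 2 - (δ + 6) / ((δ + 2) * (δ + 3)) + 3 / (2 * (δ + 1) * (δ + 3)))
          - (r / R) ^ 2 / 2
          + ((δ + 6) / ((δ + 2) * (δ + 3))) * (r / R) ^ (δ + 2)
          - (3 / (2 * (δ + 1) * (δ + 3))) * (r / R) ^ (2 * δ + 2)) := by
  have h3 : δ + 3 ≠ 0 := by positivity
  have h2 : δ + 2 ≠ 0 := by positivity
  have h1 : δ + 1 ≠ 0 := by positivity
  have hR' : R ≠ 0 := hR.ne'
  have hcongr : ∫ t in r..R, (M t / t ^ 2) * ρ t =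
      ∫ t in r..R, (4 * π / 3) * ρc ^ 2 * R * ((t / R) - (δ + 6) / (δ + 3) * (t / R) ^ (δ + 1)
        + 3 / (δ + 3) * (t / R) ^ (2 * δ + 1)) := by
    apply intervalIntegral.integral_congr
    intro t ht
    rw [Set.uIcc_of_le hrR] at ht
    have ht0 : 0 ≤ t := hr0.trans ht.1
    have hx : 0 ≤ t / R := by positivity
    simp only [hρ, hM]
    rw [Real.rpow_add_one' hx (by positivity), Real.rpow_add_one' hx (by positivity),
      two_mul δ, Real.rpow_add' hx (by positivity)]
    rcases ht0.eq_or_lt with h | h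
    · subst h; simp
    · generalize (t / R) ^ δ = y
      field_simp
      ring
  have hderiv : ∀ t ∈ Set.uIcc r R, HasDerivAt (fun t : ℝ => (4 * π / 3) * ρc ^ 2 * R ^ 2 *
      ((t / R) ^ 2 / 2 - (δ + 6) / ((δ + 2) * (δ + 3)) * (t / R) ^ (δ + 2)
        + 3 / (2 * (δ + 1) * (δ + 3)) * (t / R) ^ (2 * δ + 2)))
      ((4 * π / 3) * ρc ^ 2 * R * ((t / R) - (δ + 6) / (δ + 3) * (t / R) ^ (δ + 1)
        + 3 / (δ + 3) * (t / R) ^ (2 * δ + 1))) t := by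
    intro t _
    have hd : HasDerivAt (fun t : ℝ => t / R) (1 / R) t := (hasDerivAt_id t).div_const R
    have ha := hd.rpow_const (p := δ + 2) (Or.inr (by linarith))
    have hb := hd.rpow_const (p := 2 * δ + 2) (Or.inr (by linarith))
    have hc := (((((hd.pow 2).div_const 2).sub
      (ha.const_mul ((δ + 6) / ((δ + 2) * (δ + 3))))).add
      (hb.const_mul (3 / (2 * (δ + 1) * (δ + 3)))))).const_mul ((4 * π / 3) * ρc ^ 2 * R ^ 2)
    refine hc.congr_deriv ?_
    rw [show δ + 2 - 1 = δ + 1 by ring, show 2 * δ + 2 - 1 = 2 * δ + 1 by ring]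
    generalize (t / R) ^ (δ + 1) = y
    generalize (t / R) ^ (2 * δ + 1) = z
    norm_num
    field_simp
  have hcont : Continuous (fun t : ℝ => (4 * π / 3) * ρc ^ 2 * R *
      ((t / R) - (δ + 6) / (δ + 3) * (t / R) ^ (δ + 1)
        + 3 / (δ + 3) * (t / R) ^ (2 * δ + 1))) := by
    have c0 : Continuous (fun t : ℝ => t / R) := continuous_id.div_const R
    have c1 := c0.rpow_const (p := δ + 1) (fun _ => Or.inr (by linarith))
    have c2 := c0.rpow_const (p := 2 * δ + 1) (fun _ => Or.inr (by linarith))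
    exact continuous_const.mul ((c0.sub (continuous_const.mul c1)).add (continuous_const.mul c2))
  rw [hcongr, intervalIntegral.integral_eq_sub_of_hasDerivAt hderiv
    (hcont.intervalIntegrable _ _), div_self hR', Real.one_rpow, Real.one_rpow]
  ring
end

section
/- Let ρ_c > 0, R > 0, δ > 0, γ > 0 be real numbers. Then for every r with 0 ≤ r < R, the enclosed mass of the two-parameter stellar model satisfies M(r) = 4π·ρ_c·∫₀^r t²·(1 − (t/R)^δ)^γ dt = (4π/3)·ρ_c·r³· Σ_{m=0}^∞ [ (−γ)_m·(3/δ)_m / ((3/δ + 1)_m · m!) ]·((r/R)^δ)^m, and the series converges absolutely; i.e., M(r) = (4π/3)·ρ_c·r³·₂F₁(−γ, 3/δ; 3/δ + 1; (r/R)^δ) in terms of Gauss' hypergeometric series. -/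
open Real MeasureTheory

lemma aux_binom (γ x : ℝ) (hx0 : 0 ≤ x) (hx : x < 1) :
    HasSum (fun m : ℕ => (ascPochhammer ℝ m).eval (-γ) / (Nat.factorial m : ℝ) * x ^ m)
      ((1 - x) ^ γ) := by
  have h := (Real.one_div_one_sub_rpow_hasFPowerSeriesOnBall_zero (-γ)).hasSum (y := x) (by
    rw [← ENNReal.ofReal_one, Metric.eball_ofReal]
    simp [abs_of_nonneg hx0, hx])
  have h1 : (1 - x) ^ γ = 1 / (1 - (0 + x)) ^ (-γ) := by
    rw [zero_add, Real.rpow_neg (by linarith)]; simp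
  rw [h1]
  refine h.congr_fun ?_
  intro m
  have h2 := Ring.factorial_nsmul_multichoose_eq_ascPochhammer (-γ) m
  rw [Polynomial.ascPochhammer_smeval_eq_eval, Ring.multichoose_eq, nsmul_eq_mul] at h2
  have h3 : (Nat.factorial m : ℝ) ≠ 0 := by positivity
  rw [← h2]
  rw [mul_div_cancel_left₀ _ h3]
  simp [FormalMultilinearSeries.ofScalars]

lemma aux_poch (a : ℝ) (ha : 0 < a) (m : ℕ) :
    (ascPochhammer ℝ m).eval a / (ascPochhammer ℝ m).eval (a + 1) = a / (a + m) := by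
  have h1 := ascPochhammer_succ_eval (S := ℝ) m a
  have h2 : (ascPochhammer ℝ (m + 1)).eval a = a * (ascPochhammer ℝ m).eval (a + 1) := by
    rw [ascPochhammer_succ_left]; simp
  have h3 := ascPochhammer_pos m (a + 1) (by linarith)
  have h4 : 0 < a + m := by positivity
  rw [div_eq_div_iff h3.ne' h4.ne', ← h1, h2]

lemma aux_int (R δ r : ℝ) (hR : 0 < R) (hδ : 0 < δ) (hr0 : 0 ≤ r) (m : ℕ) :
    ∫ t in (0:ℝ)..r, t ^ 2 * ((t / R) ^ δ) ^ m = r ^ 3 * ((r / R) ^ δ) ^ m / (3 + δ * m) := by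
  have hm : 0 ≤ δ * m := by positivity
  have key : ∀ t : ℝ, 0 ≤ t → ((t / R) ^ δ) ^ m = t ^ (δ * m) / R ^ (δ * m) := by
    intro t ht
    rw [← Real.rpow_natCast, ← Real.rpow_mul (by positivity), Real.div_rpow ht hR.le]
  have : ∫ t in (0:ℝ)..r, t ^ 2 * ((t / R) ^ δ) ^ m
      = ∫ t in (0:ℝ)..r, t ^ (2 + δ * m) / R ^ (δ * m) := by
    apply intervalIntegral.integral_congr
    intro t ht
    rw [Set.uIcc_of_le hr0] at ht
    simp only
    rw [key t ht.1, Real.rpow_add_of_nonneg ht.1 (by norm_num) hm]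
    norm_cast
    ring
  rw [this, intervalIntegral.integral_div, integral_rpow (Or.inl (by linarith)), key r hr0,
    show 2 + δ * m + 1 = 3 + δ * m by ring, Real.zero_rpow (by positivity),
    Real.rpow_add_of_nonneg hr0 (by norm_num) hm]
  have : r ^ (3:ℝ) = r ^ 3 := by norm_cast
  rw [this]
  field_simp
  ring

theorem two_parameter_model_mass (ρc R δ γ : ℝ)
    (hρc : 0 < ρc) (hR : 0 < R) (hδ : 0 < δ) (hγ : 0 < γ)
    (r : ℝ) (hr0 : 0 ≤ r) (hrR : r < R) :
    HasSum
      (fun m : ℕ =>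
        (4 * π / 3) * ρc * r ^ 3 *
          ((ascPochhammer ℝ m).eval (-γ) * (ascPochhammer ℝ m).eval (3 / δ) /
            ((ascPochhammer ℝ m).eval (3 / δ + 1) * (Nat.factorial m : ℝ))) *
          ((r / R) ^ δ) ^ m)
      (4 * π * ρc * ∫ t in (0:ℝ)..r, t ^ 2 * (1 - (t / R) ^ δ) ^ γ) := by
  have hx : ∀ t : ℝ, 0 ≤ t → t ≤ r → 0 ≤ (t / R) ^ δ ∧ (t / R) ^ δ < 1 := by
    intro t ht htr
    refine ⟨by positivity, Real.rpow_lt_one (by positivity) ?_ hδ⟩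
    rw [div_lt_one hR]; linarith
  set c : ℕ → ℝ := fun m => (ascPochhammer ℝ m).eval (-γ) / (Nat.factorial m : ℝ) with hc
  have hsum : Summable fun m : ℕ => r ^ 2 * ‖c m * ((r / R) ^ δ) ^ m‖ :=
    ((aux_binom γ _ (hx r hr0 le_rfl).1 (hx r hr0 le_rfl).2).summable.norm).mul_left _
  have H : HasSum (fun m : ℕ => ∫ t in (0:ℝ)..r, t ^ 2 * (c m * ((t / R) ^ δ) ^ m))
      (∫ t in (0:ℝ)..r, t ^ 2 * (1 - (t / R) ^ δ) ^ γ) := by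
    refine intervalIntegral.hasSum_integral_of_dominated_convergence
      (fun m _ => r ^ 2 * ‖c m * ((r / R) ^ δ) ^ m‖) ?_ ?_ ?_ ?_ ?_
    · intro m
      apply Measurable.aestronglyMeasurable
      fun_prop
    · intro m
      refine Filter.Eventually.of_forall fun t ht => ?_
      rw [Set.uIoc_of_le hr0] at ht
      have h1 := hx t ht.1.le ht.2
      have ht0 := ht.1.le
      have : (t / R) ^ δ ≤ (r / R) ^ δ := by
        have := ht.2
        gcongr
      rw [norm_mul, norm_mul, norm_mul, Real.norm_of_nonneg (pow_nonneg h1.1 m),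
        Real.norm_of_nonneg (pow_nonneg (hx r hr0 le_rfl).1 m), Real.norm_of_nonneg (sq_nonneg t)]
      have := ht.2
      have := h1.1
      gcongr
    · exact Filter.Eventually.of_forall fun t ht => hsum
    · simp
    · refine Filter.Eventually.of_forall fun t ht => ?_
      rw [Set.uIoc_of_le hr0] at ht
      have h1 := hx t ht.1.le ht.2
      exact (aux_binom γ _ h1.1 h1.2).mul_left _
  refine (H.mul_left (4 * π * ρc)).congr_fun ?_
  intro m
  have e : ∀ t : ℝ, t ^ 2 * (c m * ((t / R) ^ δ) ^ m) = c m * (t ^ 2 * ((t / R) ^ δ) ^ m) := by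
    intro t; ring
  simp only [e]
  rw [intervalIntegral.integral_const_mul, aux_int R δ r hR hδ hr0 m]
  have hp := aux_poch (3 / δ) (by positivity) m
  rw [mul_comm ((ascPochhammer ℝ m).eval (-γ)), mul_div_mul_comm, hp]
  have : 3 / δ / (3 / δ + m) = 3 / (3 + δ * m) := by
    have : 0 < 3 / δ + m := by positivity
    field_simp
  rw [this]
  simp only [hc]
  ring
end

section
/- Let ρ_c > 0, R > 0, G > 0, δ > 0, γ > 0 be real numbers, let ρ(t) = ρ_c·(1 − (t/R)^δ)^γ and M(t) = 4π·ρ_c·∫₀^t u²·(1 − (u/R)^δ)^γ du. Then for every r with 0 ≤ r ≤ R, the pressure satisfies P(r) = G·∫_r^R (M(t)/t²)·ρ(t) dt = (4πG·ρ_c²/δ²)· Σ_{m=0}^∞ Σ_{j=0}^∞ [ (−γ)_m·(−γ)_j / ( m!·j!·(3/δ + m)·(2/δ + m + j) ) ]·[ R² − r²·((r/R)^δ)^{m+j} ], where the double series converges absolutely. -/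
open Real MeasureTheory

lemma hasSum_transfer {ι : Type*} {f g : ι → ℝ} {a b : ℝ} (h : HasSum f a)
    (hfg : ∀ i, g i = f i) (hab : b = a) : HasSum g b := by
  have : g = f := funext hfg
  rw [this, hab]
  exact h

/-- The binomial coefficients `(-γ)_n / n!`. -/
noncomputable def binC (γ : ℝ) (n : ℕ) : ℝ :=
  (ascPochhammer ℝ n).eval (-γ) / (Nat.factorial n : ℝ)

lemma binC_succ (γ : ℝ) (n : ℕ) : ((n : ℝ) + 1) * binC γ (n + 1) = (n - γ) * binC γ n := by
  unfold binC
  rw [ascPochhammer_succ_eval, Nat.factorial_succ]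
  have : (Nat.factorial n : ℝ) ≠ 0 := by positivity
  push_cast
  field_simp
  ring

lemma summable_binC (γ : ℝ) (hγ : 0 < γ) : Summable (fun n => |binC γ n|) := by
  obtain ⟨N, hN⟩ := exists_nat_ge γ
  rw [← summable_nat_add_iff N]
  have key : ∀ n : ℕ, γ * |binC γ (n + N)|
      = ((n + N : ℕ) : ℝ) * |binC γ (n + N)| - ((n + N : ℕ) + 1 : ℝ) * |binC γ (n + N + 1)| := by
    intro n
    have h := congrArg abs (binC_succ γ (n + N))
    rw [abs_mul, abs_mul, abs_of_nonneg (a := ((n + N : ℕ) : ℝ) + 1) (by positivity),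
      abs_of_nonneg (a := ((n + N : ℕ) : ℝ) - γ)] at h
    · rw [h]; ring
    · push_cast
      have : (0 : ℝ) ≤ n := by positivity
      linarith
  have hs : ∀ n : ℕ, γ * ∑ i ∈ Finset.range n, |binC γ (i + N)|
      = (N : ℝ) * |binC γ N| - ((n + N : ℕ) : ℝ) * |binC γ (n + N)| := by
    intro n
    induction n with
    | zero => simp
    | succ k ih =>
      rw [Finset.sum_range_succ, mul_add, ih, key]
      have : k + 1 + N = k + N + 1 := by ring
      rw [this]
      push_cast
      ring
  refine summable_of_sum_range_le (c := (N : ℝ) * |binC γ N| / γ) (fun _ => abs_nonneg _) ?_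
  intro n
  rw [le_div_iff₀ hγ, mul_comm, hs]
  have : 0 ≤ ((n + N : ℕ) : ℝ) * |binC γ (n + N)| := by positivity
  linarith

lemma hasSum_binC (γ x : ℝ) (hx0 : 0 ≤ x) (hx : x < 1) :
    HasSum (fun n => binC γ n * x ^ n) ((1 - x) ^ γ) := by
  have h := (one_div_one_sub_rpow_hasFPowerSeriesOnBall_zero (-γ)).hasSum (y := x) (by
    simp [enorm_eq_nnnorm]
    rw [← NNReal.coe_lt_coe]
    simpa [abs_of_nonneg hx0] using hx)
  refine hasSum_transfer h (fun n => ?_) ?_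
  · simp only [← Ring.multichoose_eq]
    have h2 := Ring.factorial_nsmul_multichoose_eq_ascPochhammer (-γ) n
    rw [Polynomial.ascPochhammer_smeval_eq_eval] at h2
    have : (Nat.factorial n : ℝ) ≠ 0 := by positivity
    simp [binC, ← h2, FormalMultilinearSeries.ofScalars]
    field_simp
    exact Or.inl trivial
  · simp only [zero_add]
    rw [rpow_neg (by linarith)]
    simp

lemma pow_form (R δ t : ℝ) (hR : 0 < R) (hδ : 0 < δ) (ht : 0 ≤ t) (k n : ℕ) :
    t ^ k * ((t / R) ^ δ) ^ n = t ^ ((k : ℝ) + δ * n) * ((R ^ δ) ^ n)⁻¹ := by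
  rw [rpow_add_of_nonneg ht (by positivity) (by positivity), rpow_natCast, rpow_mul ht,
    rpow_natCast, div_rpow ht hR.le, div_pow]
  ring

lemma integral_pow_form (R δ a b : ℝ) (hR : 0 < R) (hδ : 0 < δ) (ha : 0 ≤ a) (hab : a ≤ b)
    (k n : ℕ) :
    ∫ t in a..b, t ^ k * ((t / R) ^ δ) ^ n =
      (b ^ (k + 1) * ((b / R) ^ δ) ^ n - a ^ (k + 1) * ((a / R) ^ δ) ^ n) / (k + 1 + δ * n) := by
  rw [pow_form R δ b hR hδ (ha.trans hab), pow_form R δ a hR hδ ha]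
  rw [intervalIntegral.integral_congr
    (g := fun t => t ^ ((k : ℝ) + δ * n) * ((R ^ δ) ^ n)⁻¹)]
  · rw [intervalIntegral.integral_mul_const, integral_rpow]
    · push_cast
      rw [show (k : ℝ) + δ * n + 1 = k + 1 + δ * n by ring]
      ring
    · left
      have : 0 ≤ (k : ℝ) + δ * n := by positivity
      linarith
  · intro t ht
    rw [Set.uIcc_of_le hab] at ht
    exact pow_form R δ t hR hδ (ha.trans ht.1) k n

lemma ratio_bd (R δ t : ℝ) (hR : 0 < R) (hδ : 0 < δ) (ht : 0 ≤ t) (htR : t ≤ R) :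
    0 ≤ (t / R) ^ δ ∧ (t / R) ^ δ ≤ 1 :=
  ⟨by positivity, rpow_le_one (by positivity) (by rwa [div_le_one hR]) hδ.le⟩

lemma ratio_lt (R δ t : ℝ) (hR : 0 < R) (hδ : 0 < δ) (ht : 0 ≤ t) (htR : t < R) :
    (t / R) ^ δ < 1 :=
  rpow_lt_one (by positivity) (by rwa [div_lt_one hR]) hδ

lemma mass_hasSum (R δ γ t : ℝ) (hR : 0 < R) (hδ : 0 < δ) (hγ : 0 < γ) (ht : 0 ≤ t)
    (htR : t < R) :
    HasSum (fun m : ℕ => binC γ m * (t ^ 3 * ((t / R) ^ δ) ^ m / (3 + δ * m)))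
      (∫ u in (0:ℝ)..t, u ^ 2 * (1 - (u / R) ^ δ) ^ γ) := by
  have h := intervalIntegral.hasSum_integral_of_dominated_convergence (μ := volume)
    (a := 0) (b := t)
    (F := fun (m : ℕ) u => binC γ m * (u ^ 2 * ((u / R) ^ δ) ^ m))
    (f := fun u => u ^ 2 * (1 - (u / R) ^ δ) ^ γ)
    (fun m _ => |binC γ m| * R ^ 2) ?_ ?_ ?_ ?_ ?_
  · refine hasSum_transfer h (fun m => ?_) rfl
    rw [intervalIntegral.integral_const_mul, integral_pow_form R δ 0 t hR hδ le_rfl ht]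
    norm_num
  · intro m
    exact Measurable.aestronglyMeasurable (by fun_prop)
  · intro m
    refine Filter.Eventually.of_forall fun u hu => ?_
    rw [Set.uIoc_of_le ht] at hu
    obtain ⟨h0, h1⟩ := ratio_bd R δ u hR hδ hu.1.le (hu.2.trans htR.le)
    have hu0 := hu.1.le
    rw [norm_eq_abs, abs_mul, abs_of_nonneg (a := u ^ 2 * _) (by positivity)]
    gcongr
    calc u ^ 2 * ((u / R) ^ δ) ^ m ≤ u ^ 2 * 1 := by gcongr; exact pow_le_one₀ h0 h1
      _ ≤ R ^ 2 := by rw [mul_one]; gcongr; exact hu.2.trans htR.le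
  · exact Filter.Eventually.of_forall fun u hu => (summable_binC γ hγ).mul_right _
  · exact intervalIntegrable_const
  · refine Filter.Eventually.of_forall fun u hu => ?_
    rw [Set.uIoc_of_le ht] at hu
    have := (hasSum_binC γ _ (ratio_bd R δ u hR hδ hu.1.le (hu.2.trans htR.le)).1
      (ratio_lt R δ u hR hδ hu.1.le (hu.2.trans_lt htR))).mul_left (u ^ 2)
    exact hasSum_transfer this (fun m => by ring) rfl

lemma integrand_hasSum (R δ γ t : ℝ) (hR : 0 < R) (hδ : 0 < δ) (hγ : 0 < γ) (ht : 0 < t)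
    (htR : t < R) :
    HasSum (fun mj : ℕ × ℕ => binC γ mj.1 * binC γ mj.2 / (3 + δ * mj.1) *
        (t ^ 1 * ((t / R) ^ δ) ^ (mj.1 + mj.2)))
      ((∫ u in (0:ℝ)..t, u ^ 2 * (1 - (u / R) ^ δ) ^ γ) / t ^ 2 * (1 - (t / R) ^ δ) ^ γ) := by
  obtain ⟨h0, h1⟩ := ratio_bd R δ t hR hδ ht.le htR.le
  have hm := (mass_hasSum R δ γ t hR hδ hγ ht.le htR).div_const (t ^ 2)
  have hj := hasSum_binC γ _ h0 (ratio_lt R δ t hR hδ ht.le htR)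
  have h := hm.mul hj (summable_mul_of_summable_norm hm.summable.norm hj.summable.norm)
  refine hasSum_transfer h (fun mj => ?_) rfl
  have : (3 + δ * mj.1) ≠ 0 := by positivity
  field_simp
  ring

theorem two_parameter_model_pressure (ρc R G δ γ : ℝ)
    (hρc : 0 < ρc) (hR : 0 < R) (hG : 0 < G) (hδ : 0 < δ) (hγ : 0 < γ)
    (ρ M : ℝ → ℝ)
    (hρ : ∀ t, ρ t = ρc * (1 - (t / R) ^ δ) ^ γ)
    (hM : ∀ t, M t = 4 * π * ρc * ∫ u in (0:ℝ)..t, u ^ 2 * (1 - (u / R) ^ δ) ^ γ)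
    (r : ℝ) (hr0 : 0 ≤ r) (hrR : r ≤ R) :
    HasSum
      (fun mj : ℕ × ℕ =>
        (4 * π * G * ρc ^ 2 / δ ^ 2) *
          ((ascPochhammer ℝ mj.1).eval (-γ) * (ascPochhammer ℝ mj.2).eval (-γ) /
            ((Nat.factorial mj.1 : ℝ) * (Nat.factorial mj.2 : ℝ) *
              (3 / δ + mj.1) * (2 / δ + mj.1 + mj.2))) *
          (R ^ 2 - r ^ 2 * ((r / R) ^ δ) ^ (mj.1 + mj.2)))
      (G * ∫ t in r..R, (M t / t ^ 2) * ρ t) := by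
  have h := intervalIntegral.hasSum_integral_of_dominated_convergence (μ := volume)
    (a := r) (b := R)
    (F := fun (mj : ℕ × ℕ) t => binC γ mj.1 * binC γ mj.2 / (3 + δ * mj.1) *
        (t ^ 1 * ((t / R) ^ δ) ^ (mj.1 + mj.2)))
    (f := fun t => (∫ u in (0:ℝ)..t, u ^ 2 * (1 - (u / R) ^ δ) ^ γ) / t ^ 2 *
        (1 - (t / R) ^ δ) ^ γ)
    (fun mj _ => |binC γ mj.1| * |binC γ mj.2| * R) ?_ ?_ ?_ ?_ ?_
  · refine hasSum_transfer (h.mul_left (4 * π * G * ρc ^ 2)) (fun mj => ?_) ?_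
    · rw [intervalIntegral.integral_const_mul, integral_pow_form R δ r R hR hδ hr0 hrR,
        div_self hR.ne', one_rpow, one_pow]
      have e1 : (3 + δ * mj.1) ≠ 0 := by positivity
      have e2 : (2 + δ * (mj.1 + mj.2)) ≠ 0 := by positivity
      have e3 : 3 / δ + mj.1 = (3 + δ * mj.1) / δ := by field_simp
      have e4 : 2 / δ + mj.1 + mj.2 = (2 + δ * (mj.1 + mj.2)) / δ := by field_simp; ring
      have e5 : ((1 : ℕ) : ℝ) + 1 + δ * ((mj.1 + mj.2 : ℕ) : ℝ) = 2 + δ * (mj.1 + mj.2) := by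
        push_cast; ring
      have f1 : (Nat.factorial mj.1 : ℝ) ≠ 0 := by positivity
      have f2 : (Nat.factorial mj.2 : ℝ) ≠ 0 := by positivity
      rw [e3, e4, e5]
      unfold binC
      field_simp
      ring
    · rw [← intervalIntegral.integral_const_mul, ← intervalIntegral.integral_const_mul]
      congr 1
      ext t
      rw [hM, hρ]
      ring
  · intro m
    exact Measurable.aestronglyMeasurable (by fun_prop)
  · intro mj
    refine Filter.Eventually.of_forall fun u hu => ?_
    rw [Set.uIoc_of_le hrR] at hu
    have hu0 : 0 ≤ u := hr0.trans hu.1.le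
    obtain ⟨h0, h1⟩ := ratio_bd R δ u hR hδ hu0 hu.2
    have e1 : 1 ≤ (3 + δ * mj.1) := by
      have : 0 ≤ δ * mj.1 := by positivity
      linarith
    rw [norm_eq_abs, abs_mul, abs_of_nonneg (a := u ^ 1 * _) (by positivity), abs_div, abs_mul,
      abs_of_nonneg (a := 3 + _) (by positivity)]
    gcongr
    · exact div_le_self (by positivity) e1
    calc u ^ 1 * ((u / R) ^ δ) ^ (mj.1 + mj.2) ≤ u ^ 1 * 1 := by gcongr; exact pow_le_one₀ h0 h1
      _ ≤ R := by rw [mul_one, pow_one]; exact hu.2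
  · have hs := summable_binC γ hγ
    have := summable_mul_of_summable_norm hs.norm hs.norm
    exact Filter.Eventually.of_forall fun u hu => this.mul_right _
  · exact intervalIntegrable_const
  · have hne : ∀ᵐ t : ℝ, t ≠ R := by simp [ae_iff]
    filter_upwards [hne] with t htne ht
    rw [Set.uIoc_of_le hrR] at ht
    exact integrand_hasSum R δ γ t hR hδ hγ (hr0.trans_lt ht.1) (lt_of_le_of_ne ht.2 htne)
end

section
/- (Theorem 3.1, Mellin–Barnes form.) Let m, n be positive integers, let p > 0, z > 0 and r be real numbers, and let σ be a real number with σ > 0 and σ > n·r − 1. Then p·∫₀^∞ exp(−p·t)·t^{−nr}·exp(−z·t^{−n/m}) dt = p^{nr}·(m/n)·(1/(2π))·∫_{−∞}^{∞} Γ((m/n)·(σ + iτ))·Γ(1 − n·r + σ + iτ)·(p·z^{m/n})^{−(σ + iτ)} dτ, where the left side is a real integral, Γ is the complex Gamma function, and (p·z^{m/n})^{−(σ+iτ)} is the complex power of the positive real number p·z^{m/n}. -/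
open Real MeasureTheory Complex

lemma norm_Gamma_le_aux {s : ℂ} (hs : 0 < s.re) : ‖Complex.Gamma s‖ ≤ Real.Gamma s.re := by
  rw [Complex.Gamma_eq_integral hs, Real.Gamma_eq_integral hs, Complex.GammaIntegral]
  refine (norm_integral_le_integral_norm _).trans (le_of_eq ?_)
  refine setIntegral_congr_fun measurableSet_Ioi fun x hx => ?_
  have hx : 0 < x := hx
  simp only [norm_mul, Complex.norm_real, Real.norm_eq_abs, Real.abs_exp,
    Complex.norm_cpow_eq_rpow_re_of_pos hx, Complex.sub_re, Complex.one_re]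

lemma continuous_Gamma_line {a : ℝ} (ha : 0 < a) :
    Continuous (fun τ : ℝ => Complex.Gamma (a + τ * I)) := by
  rw [continuous_iff_continuousAt]
  intro τ
  have h1 : ContinuousAt Complex.Gamma (a + τ * I) := by
    apply Complex.continuousAt_Gamma
    intro k h
    have := congrArg Complex.re h
    simp at this
    have hk : (0:ℝ) ≤ k := Nat.cast_nonneg k
    linarith
  exact ContinuousAt.comp (f := fun τ : ℝ => (a + τ * I : ℂ)) h1 (by fun_prop)

lemma integrable_Gamma_line {a : ℝ} (ha : 0 < a) :
    Integrable (fun τ : ℝ => Complex.Gamma (a + τ * I)) := by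
  have hK : 0 < min (a ^ 2) 1 := lt_min (by positivity) one_pos
  refine Integrable.mono' (integrable_inv_one_add_sq.const_mul
    (Real.Gamma (a + 2) / min (a ^ 2) 1)) (continuous_Gamma_line ha).aestronglyMeasurable ?_
  refine Filter.Eventually.of_forall fun τ => ?_
  set s : ℂ := a + τ * I with hs
  have hre : s.re = a := by simp [hs]
  have him : s.im = τ := by simp [hs]
  have hs0 : s ≠ 0 := fun h => by rw [h] at hre; simp at hre; linarith
  have hs1 : s + 1 ≠ 0 := fun h => by
    have := congrArg Complex.re h
    simp [hre] at this; linarith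
  have hG : Complex.Gamma (s + 1 + 1) = (s + 1) * (s * Complex.Gamma s) := by
    rw [Complex.Gamma_add_one _ hs1, Complex.Gamma_add_one _ hs0]
  have hb := norm_Gamma_le_aux (s := s + 1 + 1) (by simp [hre]; linarith)
  rw [hG, norm_mul, norm_mul] at hb
  have hre2 : (s + 1 + 1).re = a + 2 := by simp [hre]; ring
  rw [hre2] at hb
  have hn0 : ‖s‖ ^ 2 = a ^ 2 + τ ^ 2 := by
    rw [Complex.sq_norm, Complex.normSq_apply, hre, him]; ring
  have hn1 : ‖s + 1‖ ^ 2 = (a + 1) ^ 2 + τ ^ 2 := by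
    rw [Complex.sq_norm, Complex.normSq_apply]; simp [hre, him]; ring
  have hle : ‖s‖ ≤ ‖s + 1‖ := by
    apply (sq_le_sq₀ (norm_nonneg _) (norm_nonneg _)).mp
    rw [hn0, hn1]; nlinarith
  have hlow : min (a ^ 2) 1 * (1 + τ ^ 2) ≤ ‖s + 1‖ * ‖s‖ := by
    have h1 : min (a ^ 2) 1 ≤ a ^ 2 := min_le_left _ _
    have h2 : min (a ^ 2) 1 ≤ 1 := min_le_right _ _
    have h3 : ‖s‖ ^ 2 ≤ ‖s + 1‖ * ‖s‖ := by nlinarith [norm_nonneg s]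
    nlinarith [sq_nonneg τ]
  have hpos : 0 < min (a ^ 2) 1 * (1 + τ ^ 2) := by positivity
  have : ‖Complex.Gamma s‖ ≤ Real.Gamma (a + 2) / (min (a ^ 2) 1 * (1 + τ ^ 2)) := by
    rw [le_div_iff₀ hpos]
    nlinarith [mul_le_mul_of_nonneg_right hlow (norm_nonneg (Complex.Gamma s))]
  refine this.trans (le_of_eq ?_)
  field_simp

lemma exp_neg_eq_mellinBarnes {a v : ℝ} (ha : 0 < a) (hv : 0 < v) :
    ((Real.exp (-v) : ℝ) : ℂ) =
      (1 / (2 * (π : ℂ))) * ∫ y : ℝ, (v : ℂ) ^ (-((a : ℂ) + y * I)) *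
        Complex.Gamma (a + y * I) := by
  have hmel : ∀ y : ℝ, mellin (fun x : ℝ => ((Real.exp (-x) : ℝ) : ℂ)) (a + y * I)
      = Complex.Gamma (a + y * I) := by
    intro y
    rw [Complex.Gamma_eq_integral (by simpa using ha), Complex.GammaIntegral_eq_mellin]
  have h := mellinInv_mellin_eq a (fun x : ℝ => ((Real.exp (-x) : ℝ) : ℂ)) hv ?_ ?_ ?_
  · rw [← h, mellinInv]
    simp_rw [hmel, smul_eq_mul]
    rw [Complex.real_smul]
    push_cast
    rfl
  · have := Complex.GammaIntegral_convergent (s := a) (by simpa using ha)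
    rw [MellinConvergent]
    refine this.congr_fun (fun x _ => ?_) measurableSet_Ioi
    simp [mul_comm]
  · rw [VerticalIntegrable]
    simp_rw [hmel]
    exact integrable_Gamma_line ha
  · fun_prop

lemma exp_neg_eq_scaled {c σ v : ℝ} (hc : 0 < c) (hσ : 0 < σ) (hv : 0 < v) :
    ((Real.exp (-v) : ℝ) : ℂ) =
      (c / (2 * (π : ℂ))) * ∫ τ : ℝ, (v : ℂ) ^ (-((c : ℂ) * (σ + τ * I))) *
        Complex.Gamma (c * (σ + τ * I)) := by
  rw [exp_neg_eq_mellinBarnes (mul_pos hc hσ) hv]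
  have h := Measure.integral_comp_mul_left (fun y : ℝ => (v : ℂ) ^ (-(((c * σ : ℝ) : ℂ) + y * I)) *
        Complex.Gamma ((c * σ : ℝ) + y * I)) c
  have h2 : (fun τ : ℝ => (v : ℂ) ^ (-((c : ℂ) * (σ + τ * I))) *
        Complex.Gamma (c * (σ + τ * I))) = fun τ : ℝ =>
        (v : ℂ) ^ (-(((c * σ : ℝ) : ℂ) + (c * τ : ℝ) * I)) *
        Complex.Gamma ((c * σ : ℝ) + (c * τ : ℝ) * I) := by
    funext τ
    have : (c : ℂ) * (σ + τ * I) = ((c * σ : ℝ) : ℂ) + (c * τ : ℝ) * I := by push_cast; ring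
    rw [this]
  rw [h2, h, abs_of_pos (inv_pos.mpr hc), Complex.real_smul]
  have hc' : (c : ℂ) ≠ 0 := by exact_mod_cast hc.ne'
  simp only [Complex.ofReal_inv]
  generalize (∫ y : ℝ, _ : ℂ) = J
  field_simp

lemma cpow_pos_eq {x : ℝ} (hx : 0 < x) (s : ℂ) :
    (x : ℂ) ^ s = Complex.exp ((Real.log x : ℝ) * s) := by
  rw [Complex.cpow_def_of_ne_zero (by exact_mod_cast hx.ne'), Complex.ofReal_log hx.le]

lemma collision_core {c p z q σ : ℝ} (hc : 0 < c) (hp : 0 < p) (hz : 0 < z)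
    (hσ : 0 < σ) (hσr : q - 1 < σ) :
    ((∫ t in Set.Ioi (0:ℝ),
        Real.exp (-p * t) * t ^ (-q) * Real.exp (-z * t ^ (-c⁻¹)) : ℝ) : ℂ) =
      (c / (2 * (π : ℂ))) * ∫ τ : ℝ,
          Complex.Gamma (c * ((σ : ℂ) + τ * I)) * (z : ℂ) ^ (-((c : ℂ) * (σ + τ * I))) *
          ((1 / (p : ℂ)) ^ (1 - q + σ + τ * I) * Complex.Gamma (1 - q + σ + τ * I)) := by
  set G : ℝ → ℝ → ℂ := fun t τ => ((τ : ℂ) * 0 + (t : ℂ) ^ ((τ : ℂ) * I)) *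
    (((t ^ (σ - q) * Real.exp (-p * t) : ℝ) : ℂ) *
      (Complex.Gamma (c * ((σ : ℂ) + τ * I)) * (z : ℂ) ^ (-((c : ℂ) * (σ + τ * I))))) with hG
  have hz0 : (z : ℂ) ≠ 0 := by exact_mod_cast hz.ne'
  have hzn : ∀ τ : ℝ, ‖(z : ℂ) ^ (-((c : ℂ) * (σ + τ * I)))‖ = z ^ (-(c * σ)) := by
    intro τ
    rw [Complex.norm_cpow_eq_rpow_re_of_pos hz]
    simp
  have hGc : Integrable (fun τ : ℝ => Complex.Gamma (c * ((σ : ℂ) + τ * I))) := by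
    have := (integrable_Gamma_line (mul_pos hc hσ)).comp_mul_left' hc.ne'
    refine this.congr (Filter.Eventually.of_forall fun τ => ?_)
    simp only
    congr 1
    push_cast; ring
  have hB : Integrable (fun τ : ℝ => Complex.Gamma (c * ((σ : ℂ) + τ * I)) *
      (z : ℂ) ^ (-((c : ℂ) * (σ + τ * I)))) := by
    refine hGc.mul_bdd (c := z ^ (-(c * σ))) ?_
      (Filter.Eventually.of_forall fun τ => (hzn τ).le)
    simp_rw [cpow_pos_eq hz]
    exact Continuous.aestronglyMeasurable (by fun_prop)
  have hA : Integrable (fun t : ℝ => ((t ^ (σ - q) * Real.exp (-p * t) : ℝ) : ℂ))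
      (volume.restrict (Set.Ioi 0)) := by
    have := integrableOn_rpow_mul_exp_neg_mul_rpow (p := 1) (s := σ - q) (b := p)
      (by linarith) one_pos hp
    simp only [Real.rpow_one] at this
    exact Integrable.ofReal this
  have hint : Integrable (Function.uncurry G) ((volume.restrict (Set.Ioi 0)).prod volume) := by
    refine (hA.mul_prod hB).bdd_mul (c := 1) ?_ ?_
    · apply Measurable.aestronglyMeasurable
      fun_prop
    · have : ∀ᵐ x : ℝ × ℝ ∂((volume.restrict (Set.Ioi 0)).prod volume), 0 < x.1 := by
        have h := (ae_restrict_mem (μ := volume) (measurableSet_Ioi (a := (0:ℝ))))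
        exact Measure.quasiMeasurePreserving_fst.ae h
      filter_upwards [this] with x hx
      rw [mul_zero, zero_add, Complex.norm_cpow_eq_rpow_re_of_pos hx]
      simp
  have hswap := integral_integral_swap hint
  have hL : ((∫ t in Set.Ioi (0:ℝ),
        Real.exp (-p * t) * t ^ (-q) * Real.exp (-z * t ^ (-c⁻¹)) : ℝ) : ℂ) =
      (c / (2 * (π : ℂ))) * ∫ t in Set.Ioi (0:ℝ), ∫ τ : ℝ, G t τ := by
    rw [← integral_complex_ofReal, ← integral_const_mul]
    refine setIntegral_congr_fun measurableSet_Ioi fun t ht => ?_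
    have ht : 0 < t := ht
    have hv : 0 < z * t ^ (-c⁻¹) := by positivity
    rw [Complex.ofReal_mul, neg_mul z, exp_neg_eq_scaled hc hσ hv, mul_left_comm,
      ← integral_const_mul]
    congr 1
    refine integral_congr_ae (Filter.Eventually.of_forall fun τ => ?_)
    simp only [hG]
    have hlog : Real.log (z * t ^ (-c⁻¹)) = Real.log z - c⁻¹ * Real.log t := by
      rw [Real.log_mul hz.ne' (by positivity), Real.log_rpow ht]; ring
    have e : ((t ^ (-q) : ℝ) : ℂ) * (((z * t ^ (-c⁻¹) : ℝ) : ℂ) ^ (-((c : ℂ) * (σ + τ * I))))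
        = (t : ℂ) ^ ((τ : ℂ) * I) * ((t ^ (σ - q) : ℝ) : ℂ) *
          (z : ℂ) ^ (-((c : ℂ) * (σ + τ * I))) := by
      rw [cpow_pos_eq hv, cpow_pos_eq ht, cpow_pos_eq hz, hlog, Real.rpow_def_of_pos ht,
        Real.rpow_def_of_pos ht, Complex.ofReal_exp, Complex.ofReal_exp, ← Complex.exp_add,
        ← Complex.exp_add, ← Complex.exp_add]
      congr 1
      have hc' : (c : ℂ) ≠ 0 := by exact_mod_cast hc.ne'
      push_cast
      field_simp
      ring
    rw [mul_zero, zero_add, Complex.ofReal_mul (Real.exp _), Complex.ofReal_mul (t ^ _) (Real.exp _)]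
    linear_combination (((Real.exp (-p * t) : ℝ) : ℂ) *
      Complex.Gamma (c * ((σ : ℂ) + τ * I))) * e
  rw [hL, hswap]
  congr 1
  refine integral_congr_ae (Filter.Eventually.of_forall fun τ => ?_)
  simp only
  rw [← Complex.integral_cpow_mul_exp_neg_mul_Ioi (by simp; linarith) hp, ← integral_const_mul]
  refine setIntegral_congr_fun measurableSet_Ioi fun t ht => ?_
  have ht : 0 < t := ht
  have e : (t : ℂ) ^ ((1 - q + σ + τ * I : ℂ) - 1) =
      (t : ℂ) ^ ((τ : ℂ) * I) * ((t ^ (σ - q) : ℝ) : ℂ) := by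
    rw [cpow_pos_eq ht, cpow_pos_eq ht, Real.rpow_def_of_pos ht, Complex.ofReal_exp,
      ← Complex.exp_add]
    congr 1
    push_cast
    ring
  have e2 : Complex.exp (-(p * t)) = ((Real.exp (-p * t) : ℝ) : ℂ) := by
    push_cast; ring_nf
  simp only [hG]
  rw [e, e2, mul_zero, zero_add, Complex.ofReal_mul]
  ring

theorem collision_probability_mellin_barnes (m n : ℕ) (hm : 0 < m) (hn : 0 < n)
    (p z r : ℝ) (hp : 0 < p) (hz : 0 < z)
    (σ : ℝ) (hσ : 0 < σ) (hσr : (n : ℝ) * r - 1 < σ) :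
    ((p * ∫ t in Set.Ioi (0:ℝ),
        Real.exp (-p * t) * t ^ (-((n : ℝ) * r)) * Real.exp (-z * t ^ (-((n : ℝ) / m))) : ℝ) : ℂ) =
      ((p ^ ((n : ℝ) * r) : ℝ) : ℂ) * ((m : ℂ) / n) * (1 / (2 * (π : ℂ))) *
        ∫ τ : ℝ,
          Complex.Gamma (((m : ℝ) / n) * ((σ : ℂ) + τ * Complex.I)) *
            Complex.Gamma (1 - (n : ℝ) * r + σ + τ * Complex.I) *
            (((p * z ^ ((m : ℝ) / n) : ℝ) : ℂ) ^ (-((σ : ℂ) + τ * Complex.I))) := by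
  have hm' : (0:ℝ) < m := by exact_mod_cast hm
  have hn' : (0:ℝ) < n := by exact_mod_cast hn
  have hc : (0:ℝ) < (m : ℝ) / n := by positivity
  have key := collision_core hc hp hz hσ hσr
  rw [inv_div] at key
  rw [Complex.ofReal_mul, key, ← integral_const_mul, ← integral_const_mul, ← integral_const_mul]
  refine integral_congr_ae (Filter.Eventually.of_forall fun τ => ?_)
  simp only
  have hpz : 0 < p * z ^ ((m : ℝ) / n) := by positivity
  have hlog : Real.log (p * z ^ ((m : ℝ) / n)) = Real.log p + (m : ℝ) / n * Real.log z := by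
    rw [Real.log_mul hp.ne' (by positivity), Real.log_rpow hz]
  have e : (p : ℂ) * ((z : ℂ) ^ (-((((m : ℝ) / n : ℝ) : ℂ) * (σ + τ * I))) *
      (1 / (p : ℂ)) ^ (1 - ((n * r : ℝ) : ℂ) + σ + τ * I)) =
      ((p ^ ((n : ℝ) * r) : ℝ) : ℂ) *
        (((p * z ^ ((m : ℝ) / n) : ℝ) : ℂ) ^ (-((σ : ℂ) + τ * Complex.I))) := by
    have h1 : (1 / (p : ℂ)) = ((p⁻¹ : ℝ) : ℂ) := by push_cast; simp
    have h2 : (p : ℂ) = Complex.exp (Real.log p : ℝ) := by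
      rw [← Complex.ofReal_exp, Real.exp_log hp]
    rw [h1, cpow_pos_eq hz, cpow_pos_eq (inv_pos.mpr hp), cpow_pos_eq hpz, hlog, Real.log_inv,
      Real.rpow_def_of_pos hp, Complex.ofReal_exp]
    nth_rewrite 1 [h2]
    rw [← Complex.exp_add, ← Complex.exp_add, ← Complex.exp_add]
    congr 1
    push_cast
    ring
  push_cast at e ⊢
  linear_combination ((m : ℂ) / n * (1 / (2 * (π : ℂ))) *
    Complex.Gamma (((m : ℂ) / n) * ((σ : ℂ) + τ * Complex.I)) *
            Complex.Gamma (1 - (n : ℂ) * r + σ + τ * Complex.I)) * e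
end

section
/- (Lemma 3.1b, Mellin–Barnes form of the truncated integral.) Let m, n be positive integers, let z > 0, d > 0 and μ be real numbers, and let σ be a real number with σ > 0 and σ > −(μ + 1). Then ∫₀^d y^{μ}·exp(−z·y^{−n/m}) dy = d^{μ+1}·(m/n)·(1/(2π))·∫_{−∞}^{∞} Γ((m/n)·(σ + iτ))·(μ + 1 + σ + iτ)^{−1}·(z^{m/n}/d)^{−(σ + iτ)} dτ. -/
open Real MeasureTheory Complex

lemma aux_norm_Gamma_le (s : ℂ) (hs : 0 < s.re) : ‖Complex.Gamma s‖ ≤ Real.Gamma s.re := by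
  rw [Complex.Gamma_eq_integral hs, Real.Gamma_eq_integral hs, Complex.GammaIntegral]
  refine (norm_integral_le_integral_norm _).trans (le_of_eq ?_)
  refine setIntegral_congr_fun measurableSet_Ioi fun x hx => ?_
  simp only [norm_mul, Complex.norm_real, Real.norm_eq_abs, Real.abs_exp]
  rw [Complex.norm_cpow_eq_rpow_re_of_pos hx]
  simp

lemma aux_cont (c : ℝ) (hc : 0 < c) : Continuous fun τ : ℝ => Complex.Gamma (c + τ * I) := by
  rw [continuous_iff_continuousAt]
  intro τ
  have h : ContinuousAt Complex.Gamma ((c : ℂ) + τ * I) := by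
    refine (Complex.differentiableAt_Gamma _ fun k hk => ?_).continuousAt
    have := congrArg Complex.re hk
    simp at this
    have hk : (0:ℝ) ≤ k := k.cast_nonneg
    linarith
  exact ContinuousAt.comp (f := fun τ : ℝ => (c : ℂ) + τ * I) h (by fun_prop)

lemma aux_int_s14 (c : ℝ) (hc : 0 < c) : Integrable fun τ : ℝ => Complex.Gamma (c + τ * I) := by
  refine ((integrable_inv_one_add_sq).const_mul (Real.Gamma (c+2) * (1 + 1 / c^2))).mono'
    (aux_cont c hc).aestronglyMeasurable (Filter.Eventually.of_forall fun τ => ?_)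
  set w : ℂ := c + τ * I with hw
  have hre : w.re = c := by simp [hw]
  have him : w.im = τ := by simp [hw]
  have h0 : w ≠ 0 := by intro h; rw [h] at hre; simp at hre; linarith
  have h1 : w + 1 ≠ 0 := by
    intro h
    have := congrArg Complex.re h
    simp [hre] at this; linarith
  have e : Complex.Gamma (w + 1 + 1) = (w + 1) * (w * Complex.Gamma w) := by
    rw [Complex.Gamma_add_one _ h1, Complex.Gamma_add_one _ h0]
  have b := aux_norm_Gamma_le (w + 1 + 1) (by simp [hre]; linarith)
  have hr2 : (w + 1 + 1).re = c + 2 := by simp [hre]; ring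
  rw [e, hr2, norm_mul, norm_mul] at b
  have n0 : ‖w‖ ^ 2 = c ^ 2 + τ ^ 2 := by
    rw [← Complex.normSq_eq_norm_sq, Complex.normSq_apply, hre, him]; ring
  have n1 : ‖w‖ ≤ ‖w + 1‖ := by
    refine le_of_sq_le_sq ?_ (norm_nonneg _)
    rw [← Complex.normSq_eq_norm_sq, ← Complex.normSq_eq_norm_sq, Complex.normSq_apply,
      Complex.normSq_apply]
    simp [hre, him]; nlinarith
  have hG := Real.Gamma_pos_of_pos (show 0 < c + 2 by linarith)
  have hA : (c ^ 2 + τ ^ 2) * ‖Complex.Gamma w‖ ≤ Real.Gamma (c+2) := by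
    refine le_trans ?_ b
    rw [← n0, ← mul_assoc]
    gcongr
    nlinarith [norm_nonneg w]
  have hB : 1 + τ ^ 2 ≤ (1 + 1 / c^2) * (c ^ 2 + τ ^ 2) := by
    have : (1 + 1 / c^2) * (c ^ 2 + τ ^ 2) = 1 + τ ^ 2 + c ^ 2 + τ ^ 2 / c ^ 2 := by
      field_simp; ring
    rw [this]
    have : 0 ≤ τ ^ 2 / c ^ 2 := by positivity
    nlinarith
  rw [← div_eq_mul_inv, le_div_iff₀ (by positivity)]
  calc ‖Complex.Gamma w‖ * (1 + τ ^ 2)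
      ≤ ‖Complex.Gamma w‖ * ((1 + 1 / c^2) * (c ^ 2 + τ ^ 2)) := by gcongr
    _ = (1 + 1 / c^2) * ((c ^ 2 + τ ^ 2) * ‖Complex.Gamma w‖) := by ring
    _ ≤ (1 + 1 / c^2) * Real.Gamma (c+2) := by gcongr
    _ = _ := by ring

lemma aux_inv (c : ℝ) (hc : 0 < c) (t : ℝ) (ht : 0 < t) :
    (1 / (2 * (π : ℂ))) * ∫ τ : ℝ, (t : ℂ) ^ (-((c : ℂ) + τ * I)) * Complex.Gamma (c + τ * I) =
      Real.exp (-t) := by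
  let f : ℝ → ℂ := fun x => (Real.exp (-x) : ℂ)
  have hm : ∀ s : ℂ, 0 < s.re → mellin f s = Complex.Gamma s := by
    intro s hs
    rw [Complex.Gamma_eq_integral hs, Complex.GammaIntegral_eq_mellin]
  have hre : ∀ τ : ℝ, mellin f (c + τ * I) = Complex.Gamma (c + τ * I) := fun τ =>
    hm _ (by simpa using hc)
  have := mellinInv_mellin_eq c f ht ?_ ?_ ?_
  · rw [mellinInv] at this
    simp only [hre, smul_eq_mul] at this
    refine Eq.trans ?_ this
    rw [Complex.real_smul]
    push_cast
    rfl
  · have := Complex.GammaIntegral_convergent (s := c) (by simpa using hc)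
    refine this.congr_fun (fun x hx => ?_) measurableSet_Ioi
    simp [f, mul_comm]
  · unfold VerticalIntegrable
    simp only [hre]
    exact aux_int_s14 c hc
  · exact Continuous.continuousAt (by fun_prop)

lemma aux_inv2 (a σ z y : ℝ) (ha : 0 < a) (hσ : 0 < σ) (hz : 0 < z) (hy : 0 < y) :
    (a / (2 * (π : ℂ))) * ∫ τ : ℝ, Complex.Gamma (a * ((σ : ℂ) + τ * I)) *
      (((z ^ a : ℝ) : ℂ) ^ (-((σ : ℂ) + τ * I)) * (y : ℂ) ^ ((σ : ℂ) + τ * I)) =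
      Real.exp (-z * y ^ (-(1 / a))) := by
  have h := aux_inv (a * σ) (by positivity) (z * y ^ (-(1/a))) (by positivity)
  rw [neg_mul, ← h]
  have hc := Measure.integral_comp_mul_left (fun τ : ℝ => ((z * y ^ (-(1/a)) : ℝ) : ℂ) ^ (-(((a * σ : ℝ) : ℂ) + τ * I)) * Complex.Gamma ((a * σ : ℝ) + τ * I)) a
  rw [abs_of_pos (inv_pos.2 ha)] at hc
  have hc' : (∫ τ : ℝ, ((z * y ^ (-(1/a)) : ℝ) : ℂ) ^ (-(((a * σ : ℝ) : ℂ) + τ * I)) * Complex.Gamma ((a * σ : ℝ) + τ * I)) = (a : ℂ) * ∫ τ : ℝ, ((z * y ^ (-(1/a)) : ℝ) : ℂ) ^ (-(((a * σ : ℝ) : ℂ) + (a * τ : ℝ) * I)) * Complex.Gamma ((a * σ : ℝ) + (a * τ : ℝ) * I) := by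
    rw [hc, Complex.real_smul, ← mul_assoc, ← Complex.ofReal_mul, mul_inv_cancel₀ ha.ne']
    simp
  rw [hc']
  have : ∀ τ : ℝ, ((z * y ^ (-(1/a)) : ℝ) : ℂ) ^ (-(((a * σ : ℝ) : ℂ) + (a * τ : ℝ) * I)) * Complex.Gamma ((a * σ : ℝ) + (a * τ : ℝ) * I) = Complex.Gamma (a * ((σ : ℂ) + τ * I)) *
      (((z ^ a : ℝ) : ℂ) ^ (-((σ : ℂ) + τ * I)) * (y : ℂ) ^ ((σ : ℂ) + τ * I)) := by
    intro τ
    have e1 : ((a * σ : ℝ) : ℂ) + (a * τ : ℝ) * I = a * ((σ : ℂ) + τ * I) := by push_cast; ring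
    rw [e1, mul_comm]
    congr 1
    have p1 : 0 < z * y ^ (-(1/a)) := by positivity
    have p2 : 0 < z ^ a := by positivity
    rw [Complex.cpow_def_of_ne_zero (by exact_mod_cast p1.ne'),
      Complex.cpow_def_of_ne_zero (by exact_mod_cast p2.ne'),
      Complex.cpow_def_of_ne_zero (by exact_mod_cast hy.ne'), ← Complex.exp_add,
      ← Complex.ofReal_log p1.le, ← Complex.ofReal_log p2.le, ← Complex.ofReal_log hy.le,
      Real.log_mul hz.ne' (by positivity), Real.log_rpow hz, Real.log_rpow hy]
    congr 1
    have : (a : ℂ) ≠ 0 := by exact_mod_cast ha.ne'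
    push_cast
    field_simp
    ring
  simp only [this]
  ring

lemma aux_main (a : ℝ) (ha : 0 < a)
    (z d μ : ℝ) (hz : 0 < z) (hd : 0 < d)
    (σ : ℝ) (hσ : 0 < σ) (hσμ : -(μ + 1) < σ) :
    ((∫ y in (0:ℝ)..d, y ^ μ * Real.exp (-z * y ^ (-(1 / a))) : ℝ) : ℂ) =
      ((d ^ (μ + 1) : ℝ) : ℂ) * a * (1 / (2 * (π : ℂ))) *
        ∫ τ : ℝ,
          Complex.Gamma (a * ((σ : ℂ) + τ * Complex.I)) *
            ((μ : ℂ) + 1 + σ + τ * Complex.I)⁻¹ *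
            (((z ^ a / d : ℝ) : ℂ) ^ (-((σ : ℂ) + τ * Complex.I))) := by
  have pz : 0 < z ^ a := by positivity
  have pz' : ((z ^ a : ℝ) : ℂ) ≠ 0 := by exact_mod_cast pz.ne'
  let g : ℝ → ℂ := fun τ => Complex.Gamma (a * ((σ : ℂ) + τ * I)) *
      ((z ^ a : ℝ) : ℂ) ^ (-((σ : ℂ) + τ * I))
  have hg : Integrable g := by
    have h1 := (aux_int_s14 (a * σ) (by positivity)).comp_mul_left' ha.ne'
    have h2 : Integrable fun τ : ℝ => Complex.Gamma (a * ((σ : ℂ) + τ * I)) := by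
      refine h1.congr (Filter.Eventually.of_forall fun τ => ?_)
      simp only
      congr 1; push_cast; ring
    refine h2.mul_bdd (c := (z ^ a) ^ (-σ)) ?_ (Filter.Eventually.of_forall fun τ => ?_)
    · refine Continuous.aestronglyMeasurable ?_
      exact Continuous.const_cpow (by fun_prop) (Or.inl pz')
    · rw [Complex.norm_cpow_eq_rpow_re_of_pos pz]; simp
  let K : ℝ → ℝ → ℂ := fun y τ => ((y ^ (μ + σ) : ℝ) : ℂ) * g τ * cexp (τ * Real.log y * I)
  have hf : Integrable (fun y : ℝ => ((y ^ (μ + σ) : ℝ) : ℂ)) (volume.restrict (Set.Ioc 0 d)) := by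
    have := (intervalIntegral.intervalIntegrable_rpow' (a := 0) (b := d) (r := μ + σ) (by linarith))
    exact ((intervalIntegrable_iff_integrableOn_Ioc_of_le hd.le).1 this).ofReal
  have hK : Integrable (Function.uncurry K) ((volume.restrict (Set.Ioc 0 d)).prod volume) := by
    have h := hf.mul_prod hg
    refine h.mul_bdd (c := 1) ?_ (Filter.Eventually.of_forall fun p => ?_)
    · refine Measurable.aestronglyMeasurable ?_
      fun_prop
    · have : ((p.2 : ℂ) * Real.log p.1 * I) = ((p.2 * Real.log p.1 : ℝ) : ℂ) * I := by push_cast; ring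
      rw [this, Complex.norm_exp_ofReal_mul_I]
  have hsplit : ∀ y : ℝ, 0 < y → ∀ τ : ℝ, K y τ = g τ * (y : ℂ) ^ ((μ : ℂ) + ((σ : ℂ) + τ * I)) := by
    intro y hy τ
    have hy' : (y : ℂ) ≠ 0 := by exact_mod_cast hy.ne'
    simp only [K]
    rw [Complex.ofReal_cpow hy.le, Complex.cpow_def_of_ne_zero hy', Complex.cpow_def_of_ne_zero hy',
      mul_comm _ (g τ), mul_assoc, ← Complex.exp_add, Complex.ofReal_log hy.le]
    congr 2; push_cast; ring
  have hL : ∀ y : ℝ, 0 < y → ((y ^ μ * Real.exp (-z * y ^ (-(1 / a))) : ℝ) : ℂ) =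
      (a / (2 * (π : ℂ))) * ∫ τ : ℝ, K y τ := by
    intro y hy
    have hy' : (y : ℂ) ≠ 0 := by exact_mod_cast hy.ne'
    rw [Complex.ofReal_mul, ← aux_inv2 a σ z y ha hσ hz hy, mul_left_comm, ← integral_const_mul]
    congr 2
    ext τ
    rw [hsplit y hy, Complex.cpow_add (μ : ℂ) ((σ : ℂ) + τ * I) hy', Complex.ofReal_cpow hy.le]
    simp only [g]; ring
  rw [intervalIntegral.integral_of_le hd.le, ← integral_complex_ofReal,
    setIntegral_congr_fun measurableSet_Ioc (fun y hy => hL y hy.1), integral_const_mul,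
    integral_integral_swap hK]
  have hin : ∀ τ : ℝ, ∫ y in Set.Ioc 0 d, K y τ = ((d ^ (μ + 1) : ℝ) : ℂ) *
      (Complex.Gamma (a * ((σ : ℂ) + τ * Complex.I)) *
            ((μ : ℂ) + 1 + σ + τ * Complex.I)⁻¹ *
            (((z ^ a / d : ℝ) : ℂ) ^ (-((σ : ℂ) + τ * Complex.I)))) := by
    intro τ
    have hd' : (d : ℂ) ≠ 0 := by exact_mod_cast hd.ne'
    have hne : (μ : ℂ) + ((σ : ℂ) + τ * I) + 1 ≠ 0 := by
      intro h
      have := congrArg Complex.re h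
      simp at this; linarith
    rw [setIntegral_congr_fun measurableSet_Ioc (fun y hy => hsplit y hy.1 τ), integral_const_mul,
      ← intervalIntegral.integral_of_le hd.le, integral_cpow (Or.inl (by simp; linarith))]
    rw [Complex.ofReal_zero, Complex.zero_cpow hne, sub_zero]
    have e2 : ((z ^ a / d : ℝ) : ℂ) ^ (-((σ : ℂ) + τ * Complex.I)) =
        ((z ^ a : ℝ) : ℂ) ^ (-((σ : ℂ) + τ * I)) * (d : ℂ) ^ ((σ : ℂ) + τ * I) := by
      rw [div_eq_mul_inv, Complex.ofReal_mul, Complex.mul_cpow_ofReal_nonneg pz.le (inv_pos.2 hd).le]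
      congr 1
      rw [Complex.cpow_def_of_ne_zero (by simpa using hd.ne'), Complex.cpow_def_of_ne_zero hd',
        ← Complex.ofReal_log (inv_pos.2 hd).le, ← Complex.ofReal_log hd.le, Real.log_inv]
      congr 1; push_cast; ring
    have e3 : (μ : ℂ) + ((σ : ℂ) + τ * I) + 1 = ((μ + 1 : ℝ) : ℂ) + ((σ : ℂ) + τ * I) := by
      push_cast; ring
    have e4 : (μ : ℂ) + 1 + σ + τ * I = ((μ + 1 : ℝ) : ℂ) + ((σ : ℂ) + τ * I) := by
      push_cast; ring
    rw [e2, e3, e4, Complex.cpow_add _ _ hd', Complex.ofReal_cpow hd.le]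
    simp only [g]; ring
  simp only [hin]
  rw [integral_const_mul]
  ring

theorem screened_nonresonant_N2_mellin_barnes (m n : ℕ) (hm : 0 < m) (hn : 0 < n)
    (z d μ : ℝ) (hz : 0 < z) (hd : 0 < d)
    (σ : ℝ) (hσ : 0 < σ) (hσμ : -(μ + 1) < σ) :
    ((∫ y in (0:ℝ)..d, y ^ μ * Real.exp (-z * y ^ (-((n : ℝ) / m))) : ℝ) : ℂ) =
      ((d ^ (μ + 1) : ℝ) : ℂ) * ((m : ℂ) / n) * (1 / (2 * (π : ℂ))) *
        ∫ τ : ℝ,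
          Complex.Gamma (((m : ℝ) / n) * ((σ : ℂ) + τ * Complex.I)) *
            ((μ : ℂ) + 1 + σ + τ * Complex.I)⁻¹ *
            (((z ^ ((m : ℝ) / n) / d : ℝ) : ℂ) ^ (-((σ : ℂ) + τ * Complex.I))) := by
  have h := aux_main ((m : ℝ) / n) (by positivity) z d μ hz hd σ hσ hσμ
  rw [one_div_div] at h
  rw [h]
  simp only [Complex.ofReal_div, Complex.ofReal_natCast]
end
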